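/- Let $(X, \Sigma, \mu)$ be a probability space with an ergodic measure-preserving $\mathbb{Z}^d$-action $T$. If $\{E_n\} \subset \Sigma$ satisfy $\sum_n \mu(E_n) = +\infty$, then there exist vectors $y(n) \in \mathbb{Z}^d$ such that $\limsup_n T_{-y(n)} E_n$ has full measure: $\mu(\limsup_n T_{-y(n)} E_n) = 1$. -/

import Mathlib

open MeasureTheory

open Filter Topology

open scoped RealInnerProductSpace

/-- A nonempty closed convex subset of a Hilbert space which is stable under a family of linear
isometries contains a common fixed point: its element of minimal norm. -/
theorem exists_mem_forall_isometry_apply_eq {ι H : Type*} [NormedAddCommGroup H]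
    [InnerProductSpace ℝ H] [CompleteSpace H] (U : ι → H →ₗᵢ[ℝ] H) {K : Set H}
    (hne : K.Nonempty) (hclosed : IsClosed K) (hconv : Convex ℝ K)
    (hU : ∀ i, ∀ v ∈ K, U i v ∈ K) : ∃ v ∈ K, ∀ i, U i v = v := by
  obtain ⟨v, hvK, hv⟩ := exists_norm_eq_iInf_of_complete_convex hne hclosed.isComplete hconv 0
  refine ⟨v, hvK, fun i ↦ ?_⟩
  have hw : ‖0 - U i v‖ = ⨅ w : K, ‖0 - (w : H)‖ := by
    rw [← hv, zero_sub, zero_sub, norm_neg, norm_neg, (U i).norm_map]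
  have h₁ := (norm_eq_iInf_iff_real_inner_le_zero hconv hvK).1 hv _ (hU i v hvK)
  have h₂ := (norm_eq_iInf_iff_real_inner_le_zero hconv (hU i v hvK)).1 hw v hvK
  have h₃ : ⟪U i v - v, U i v - v⟫ = ⟪0 - v, U i v - v⟫ + ⟪0 - U i v, v - U i v⟫ := by
    simp only [inner_sub_left, inner_sub_right, inner_zero_left]
    ring
  exact sub_eq_zero.1 (inner_self_eq_zero.1 (le_antisymm (by linarith) real_inner_self_nonneg))

section Action

variable {G X : Type*} [AddGroup G] [MeasurableSpace X] {μ : Measure X} {T : G → X → X}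

/-- For an ergodic action of a countable group, almost invariant sets are null or conull. -/
theorem ae_mem_or_ae_notMem_of_forall_preimage_ae_eq [Countable G] [IsProbabilityMeasure μ]
    (hact : ∀ y z, T (y + z) = T y ∘ T z) (hmp : ∀ y, MeasurePreserving (T y) μ μ)
    (herg : ∀ A : Set X, MeasurableSet A → (∀ y, T y ⁻¹' A = A) → μ A = 0 ∨ μ A = 1)
    {s : Set X} (hs : MeasurableSet s) (hinv : ∀ y, T y ⁻¹' s =ᵐ[μ] s) :
    (∀ᵐ x ∂μ, x ∈ s) ∨ ∀ᵐ x ∂μ, x ∉ s := by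
  have hmeas : MeasurableSet (⋂ y, T y ⁻¹' s) :=
    MeasurableSet.iInter fun y ↦ (hmp y).measurable hs
  have hst : (⋂ y, T y ⁻¹' s : Set X) =ᵐ[μ] s :=
    (Filter.EventuallyEq.countable_iInter hinv).trans (by rw [Set.iInter_const]; rfl)
  have hstrict : ∀ y, T y ⁻¹' (⋂ z, T z ⁻¹' s) = ⋂ z, T z ⁻¹' s := fun y ↦ by
    simp only [Set.preimage_iInter, ← Set.preimage_comp, ← hact]
    exact (Equiv.addRight y).surjective.iInter_comp fun z ↦ T z ⁻¹' s
  rcases herg _ hmeas hstrict with h | h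
  · right
    rw [measure_congr hst] at h
    exact measure_eq_zero_iff_ae_notMem.1 h
  · left
    rw [measure_congr hst] at h
    exact (mem_ae_iff_prob_eq_one hs).2 h

/-- For an ergodic action of a countable group, an upper bound for the integrals of a
square-integrable `f` over all translates of `A` also bounds `μ(A) ∫ f`. -/
theorem measureReal_mul_integral_le_of_forall_setIntegral_preimage_le [Countable G]
    [IsProbabilityMeasure μ]
    (hact : ∀ y z, T (y + z) = T y ∘ T z) (hmp : ∀ y, MeasurePreserving (T y) μ μ)
    (herg : ∀ A : Set X, MeasurableSet A → (∀ y, T y ⁻¹' A = A) → μ A = 0 ∨ μ A = 1)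
    {A : Set X} (hA : MeasurableSet A) {f : X → ℝ} (hf : MemLp f 2 μ) {c : ℝ}
    (hc : ∀ y, ∫ x in T y ⁻¹' A, f x ∂μ ≤ c) :
    μ.real A * ∫ x, f x ∂μ ≤ c := by
  let U (y : G) : Lp ℝ 2 μ →ₗᵢ[ℝ] Lp ℝ 2 μ := Lp.compMeasurePreservingₗᵢ ℝ (T y) (hmp y)
  have hUcoe (y : G) (v : Lp ℝ 2 μ) : U y v =ᵐ[μ] v ∘ T y :=
    Lp.coeFn_compMeasurePreserving v (hmp y)
  have hUadd (y z : G) (v : Lp ℝ 2 μ) : U y (U z v) = U (z + y) v := by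
    refine Lp.ext ?_
    refine (hUcoe y _).trans (.trans ?_ (hUcoe (z + y) v).symm)
    rw [hact, ← Function.comp_assoc]
    exact (hmp y).quasiMeasurePreserving.ae_eq_comp (hUcoe z v)
  let one : Lp ℝ 2 μ := indicatorConstLp 2 MeasurableSet.univ (measure_ne_top μ _) 1
  have hone (v : Lp ℝ 2 μ) : ⟪one, v⟫ = ∫ x, v x ∂μ := by
    rw [L2.inner_indicatorConstLp_one, setIntegral_univ]
  have hUone (y : G) (v : Lp ℝ 2 μ) : ⟪one, U y v⟫ = ⟪one, v⟫ := by
    rw [hone, hone, integral_congr_ae (hUcoe y v)]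
    have hv : AEStronglyMeasurable v (μ.map (T y)) := by
      rw [(hmp y).map_eq]; exact Lp.aestronglyMeasurable v
    have := integral_map (hmp y).aemeasurable hv
    rw [(hmp y).map_eq] at this
    exact this.symm
  let b : Lp ℝ 2 μ := hf.toLp f
  let K : Set (Lp ℝ 2 μ) := {v | ⟪one, v⟫ = μ.real A} ∩ ⋂ y, {v | ⟪U y v, b⟫ ≤ c}
  have hclosed : IsClosed K := by
    refine (isClosed_eq (by fun_prop) continuous_const).inter (isClosed_iInter fun y ↦ ?_)
    exact isClosed_le ((U y).continuous.inner continuous_const) continuous_const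
  have hconv : Convex ℝ K := by
    refine (convex_hyperplane ⟨inner_add_right _, fun r v ↦ ?_⟩ _).inter
      (convex_iInter fun y ↦ convex_halfSpace_le ⟨fun v w ↦ ?_, fun r v ↦ ?_⟩ _)
    · rw [real_inner_smul_right, smul_eq_mul]
    · rw [map_add, inner_add_left]
    · rw [map_smul, real_inner_smul_left, smul_eq_mul]
  have hUK : ∀ y, ∀ v ∈ K, U y v ∈ K := by
    rintro y v ⟨h₁, h₂⟩
    refine ⟨(hUone y v).trans h₁, Set.mem_iInter.2 fun z ↦ ?_⟩
    rw [Set.mem_ofPred_eq, hUadd]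
    exact Set.mem_iInter.1 h₂ (y + z)
  have hne : K.Nonempty := by
    refine ⟨indicatorConstLp 2 hA (measure_ne_top μ _) 1, ?_, Set.mem_iInter.2 fun y ↦ ?_⟩
    · rw [Set.mem_ofPred_eq, L2.real_inner_indicatorConstLp_one_indicatorConstLp_one, Set.univ_inter]
    · have hUA : U y (indicatorConstLp 2 hA (measure_ne_top μ _) 1) =
          indicatorConstLp 2 ((hmp y).measurable hA) (measure_ne_top μ _) 1 :=
        Lp.indicatorConstLp_compMeasurePreserving hA _ _ (hmp y)
      rw [Set.mem_ofPred_eq, hUA, L2.inner_indicatorConstLp_one,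
        integral_congr_ae (ae_restrict_of_ae hf.coeFn_toLp)]
      exact hc y
  obtain ⟨v, ⟨hv₁, hv₂⟩, hfix⟩ := exists_mem_forall_isometry_apply_eq U hne hclosed hconv hUK
  obtain ⟨a, ha⟩ : ∃ a, (v : X → ℝ) =ᵐ[μ] Function.const X a := by
    refine exists_eventuallyEq_const_of_forall_separating MeasurableSet fun S hS ↦ ?_
    refine ae_mem_or_ae_notMem_of_forall_preimage_ae_eq (s := v ⁻¹' S) hact hmp herg
      ((Lp.stronglyMeasurable v).measurable hS) fun y ↦ ?_
    have hy := hUcoe y v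
    rw [hfix y] at hy
    refine (hy.mono fun x hx ↦ ?_).set_eq
    rw [Set.mem_preimage, Set.mem_preimage, Set.mem_preimage, hx, Function.comp_apply]
  have haA : a = μ.real A := by
    rw [← (show _ = _ from hv₁), hone, integral_congr_ae ha]
    simp
  have h := Set.mem_iInter.1 hv₂ 0
  rw [Set.mem_ofPred_eq, hfix, L2.inner_def] at h
  have hint : ∫ x, ⟪v x, b x⟫ ∂μ = a * ∫ x, f x ∂μ := by
    rw [← integral_const_mul]
    refine integral_congr_ae ?_
    filter_upwards [ha, hf.coeFn_toLp] with x hx hbx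
    rw [hx, hbx, RCLike.inner_apply, conj_trivial, mul_comm, Function.const_apply]
  rwa [hint, haA] at h

theorem exists_half_measureReal_mul_integral_le_setIntegral_preimage [Countable G]
    [IsProbabilityMeasure μ]
    (hact : ∀ y z, T (y + z) = T y ∘ T z) (hmp : ∀ y, MeasurePreserving (T y) μ μ)
    (herg : ∀ A : Set X, MeasurableSet A → (∀ y, T y ⁻¹' A = A) → μ A = 0 ∨ μ A = 1)
    {A : Set X} (hA : MeasurableSet A) {f : X → ℝ} (hf : MemLp f 2 μ) (hf₀ : 0 ≤ f) :
    ∃ y, μ.real A / 2 * ∫ x, f x ∂μ ≤ ∫ x in T y ⁻¹' A, f x ∂μ := by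
  by_contra! hlt
  have hle := measureReal_mul_integral_le_of_forall_setIntegral_preimage_le hact hmp herg hA hf
    fun y ↦ (hlt y).le
  have hpos : 0 ≤ ∫ x in T 0 ⁻¹' A, f x ∂μ := integral_nonneg hf₀
  linarith [hlt 0]

end Action

/-- Hitting a set halves the weight: `halve F f` is `f / 2` on `F` and `f` elsewhere. -/
noncomputable def halve {X : Type*} (F : Set X) (f : X → ℝ) : X → ℝ :=
  fun x ↦ f x - F.indicator f x / 2

theorem halve_apply_of_mem {X : Type*} {F : Set X} {f : X → ℝ} {x : X} (hx : x ∈ F) :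
    halve F f x = f x / 2 := by
  rw [halve, Set.indicator_of_mem hx]; ring

theorem halve_apply_of_notMem {X : Type*} {F : Set X} {f : X → ℝ} {x : X} (hx : x ∉ F) :
    halve F f x = f x := by
  rw [halve, Set.indicator_of_notMem hx]; ring

/-- Randomization Lemma: for an ergodic measure-preserving `ℤ^d`-action on a probability
space and sets `E_n` with `∑ μ(E_n) = ∞`, there are translates `y(n)` so that
`limsup_n T_{-y(n)} E_n` has full measure. -/
theorem stmt_4 {X : Type*} [MeasurableSpace X] (μ : Measure X)
    [IsProbabilityMeasure μ] (d : ℕ)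
    (T : (Fin d → ℤ) → X → X)
    (hact : ∀ y z, T (y + z) = T y ∘ T z)
    (hid : T 0 = id)
    (hmp : ∀ y, MeasurePreserving (T y) μ μ)
    (herg : ∀ A : Set X, MeasurableSet A → (∀ y, T y ⁻¹' A = A) → μ A = 0 ∨ μ A = 1)
    (E : ℕ → Set X) (hE : ∀ n, MeasurableSet (E n))
    (hsum : ∑' n, μ (E n) = ⊤) :
    ∃ y : ℕ → Fin d → ℤ,
      μ (⋂ N : ℕ, ⋃ n : ℕ, ⋃ _ : N ≤ n, T (y n) ⁻¹' E n) = 1 := by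
  have key (n : ℕ) (f : X → ℝ) : ∃ y, MemLp f 2 μ → 0 ≤ f →
      μ.real (E n) / 2 * ∫ x, f x ∂μ ≤ ∫ x in T y ⁻¹' E n, f x ∂μ := by
    by_cases hf : MemLp f 2 μ ∧ 0 ≤ f
    · obtain ⟨y, hy⟩ := exists_half_measureReal_mul_integral_le_setIntegral_preimage
        hact hmp herg (hE n) hf.1 hf.2
      exact ⟨y, fun _ _ ↦ hy⟩
    · exact ⟨0, fun h₁ h₂ ↦ absurd ⟨h₁, h₂⟩ hf⟩
  choose Y hY using key
  let w (n : ℕ) : X → ℝ := Nat.rec 1 (fun n f ↦ halve (T (Y n f) ⁻¹' E n) f) n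
  let F (n : ℕ) : Set X := T (Y n (w n)) ⁻¹' E n
  have hF (n : ℕ) : MeasurableSet (F n) := (hmp _).measurable (hE n)
  have hw_succ (n : ℕ) : w (n + 1) = halve (F n) (w n) := rfl
  have hw_memLp (n : ℕ) : MemLp (w n) 2 μ := by
    induction n with
    | zero => exact memLp_const 1
    | succ n ih =>
      convert! ih.sub ((ih.indicator (hF n)).const_mul 2⁻¹) using 1
      ext x
      rw [hw_succ, halve, div_eq_inv_mul, Pi.sub_apply]
  have hw_lower (n : ℕ) (x : X) : (1 / 2 : ℝ) ^ n ≤ w n x := by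
    induction n with
    | zero => exact (pow_zero _).le
    | succ n ih =>
      have : (0 : ℝ) < (1 / 2) ^ n := by positivity
      rw [hw_succ, pow_succ]
      by_cases hx : x ∈ F n
      · rw [halve_apply_of_mem hx]; linarith
      · rw [halve_apply_of_notMem hx]; linarith
  have hw_nonneg (n : ℕ) : 0 ≤ w n := fun x ↦ le_trans (by positivity) (hw_lower n x)
  have hw_int (n : ℕ) :
      ∫ x, w n x ∂μ ≤ Real.exp (-((∑ m ∈ Finset.range n, μ.real (E m)) / 4)) := by
    induction n with
    | zero => simp [w]
    | succ n ih =>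
      have hi : Integrable (w n) μ := (hw_memLp n).integrable one_le_two
      have h₁ : ∫ x, w (n + 1) x ∂μ = ∫ x, w n x ∂μ - (∫ x in F n, w n x ∂μ) / 2 := by
        rw [hw_succ, ← integral_indicator (hF n), ← integral_div,
          ← integral_sub hi ((hi.indicator (hF n)).div_const 2)]
        rfl
      have h₂ := hY n (w n) (hw_memLp n) (hw_nonneg n)
      have h₃ : 0 ≤ ∫ x, w n x ∂μ := integral_nonneg (hw_nonneg n)
      calc ∫ x, w (n + 1) x ∂μ ≤ (∫ x, w n x ∂μ) * (-(μ.real (E n) / 4) + 1) := by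
            rw [h₁]; linarith
        _ ≤ (∫ x, w n x ∂μ) * Real.exp (-(μ.real (E n) / 4)) := by
            gcongr; exact Real.add_one_le_exp _
        _ ≤ _ := by
            rw [Finset.sum_range_succ, add_div, neg_add, Real.exp_add]
            gcongr
  have hsum_real : Tendsto (fun n ↦ ∑ m ∈ Finset.range n, μ.real (E m)) atTop atTop := by
    refine (not_summable_iff_tendsto_nat_atTop_of_nonneg fun _ ↦ measureReal_nonneg).1 fun h ↦ ?_
    refine h.tsum_ofReal_ne_top ?_
    simpa [ofReal_measureReal] using hsum
  have hw_tendsto : Tendsto (fun n ↦ ∫ x, w n x ∂μ) atTop (𝓝 0) := by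
    refine squeeze_zero (fun n ↦ integral_nonneg (hw_nonneg n)) hw_int ?_
    exact Real.tendsto_exp_atBot.comp
      (tendsto_neg_atTop_atBot.comp (hsum_real.atTop_div_const four_pos))
  refine ⟨fun n ↦ Y n (w n), ?_⟩
  change μ (⋂ N : ℕ, ⋃ n : ℕ, ⋃ _ : N ≤ n, F n) = 1
  have hmeas (N : ℕ) : MeasurableSet (⋃ n : ℕ, ⋃ _ : N ≤ n, F n) :=
    .iUnion fun n ↦ .iUnion fun _ ↦ hF n
  refine (mem_ae_iff_prob_eq_one (.iInter hmeas)).1 (countable_iInter_mem.2 fun N ↦ ?_)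
  rw [mem_ae_iff]
  set B : Set X := (⋃ n : ℕ, ⋃ _ : N ≤ n, F n)ᶜ
  have hBF {x : X} (hx : x ∈ B) (n : ℕ) (hn : N ≤ n) : x ∉ F n := fun hxn ↦
    hx (Set.mem_iUnion₂.2 ⟨n, hn, hxn⟩)
  have hwB (n : ℕ) (hn : N ≤ n) {x : X} (hx : x ∈ B) : (1 / 2 : ℝ) ^ N ≤ w n x := by
    induction n, hn using Nat.le_induction with
    | base => exact hw_lower N x
    | succ n hn ih => rwa [hw_succ, halve_apply_of_notMem (hBF hx n hn)]
  have hle : μ.real B * (1 / 2) ^ N ≤ 0 := by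
    refine ge_of_tendsto hw_tendsto (eventually_atTop.2 ⟨N, fun n hn ↦ ?_⟩)
    have hi : Integrable (w n) μ := (hw_memLp n).integrable one_le_two
    calc μ.real B * (1 / 2) ^ N = ∫ _ in B, (1 / 2 : ℝ) ^ N ∂μ := by
          rw [setIntegral_const, smul_eq_mul]
      _ ≤ ∫ x in B, w n x ∂μ :=
          setIntegral_mono_on (by simp) hi.integrableOn (hmeas N).compl fun x hx ↦ hwB n hn hx
      _ ≤ ∫ x, w n x ∂μ := setIntegral_le_integral hi (ae_of_all _ (hw_nonneg n))
  have hzero : μ.real B = 0 :=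
    le_antisymm (nonpos_of_mul_nonpos_left hle (by positivity)) measureReal_nonneg
  exact (measureReal_eq_zero_iff).1 hzero
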